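/- Let u be an element of a field F of characteristic zero with u ∉ {0,1}, and consider the continued fraction data of g_u(x) = x^{-1}∏_{t≥0}(1+u x^{-2^t}): if all partial quotients of g_u are linear, a_n(x) = x + α_n, with modified continued fraction parameters β_n, then for every k ≥ 0 the relations α_{2k+2} = u, α_{2k+3} = -u, β_{2k+2}β_{2k+3} = -β_{k+2}, and β_{2k+3} + β_{2k+4} = α_{k+2} + u^2 hold. -/

import Mathlib

open Polynomial
open scoped Classical

noncomputable section

variable {F : Type*} [Field F] [CharZero F]

/-- The infinite product `∏_{t=0}^∞ P(T^{d^t})` (with `T = x⁻¹`), defined coefficientwise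
via the stabilizing finite truncated products (valid when `P(0) = 1`). -/
def infProd (P : Polynomial F) (d : ℕ) : PowerSeries F :=
  PowerSeries.mk fun n => (∏ t ∈ Finset.range (n + 1), P.comp (Polynomial.X ^ d ^ t)).coeff n

/-- The element `x = T⁻¹` of `F((T))`. -/
def xx : LaurentSeries F := ((PowerSeries.X : PowerSeries F) : LaurentSeries F)⁻¹

/-- Evaluation of a polynomial in the variable `x` inside `F((x⁻¹))`. -/
def pev (p : Polynomial F) : LaurentSeries F := Polynomial.aeval (xx : LaurentSeries F) p

/-- Degree valuation `‖f‖` on `F((x⁻¹))`, with `‖0‖ = ⊥`. -/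
def degB (f : LaurentSeries F) : WithBot ℤ := if f = 0 then ⊥ else (-(f.order) : ℤ)

/-- `g_u(x) = x⁻¹ ∏_{t=0}^∞ (1 + u x^{-2^t})`. -/
def gU (u : F) : LaurentSeries F :=
  (xx : LaurentSeries F)⁻¹ *
    ((infProd (1 + Polynomial.C u * Polynomial.X) 2 : PowerSeries F) : LaurentSeries F)

/-- Numerators of the modified continued fraction `K β_i/(x+α_i)`, shifted:
`cfPab α β (n+1) = p_n`, with `p_{-1} = 1`, `p_0 = 0`. -/
def cfPab (α β : ℕ → F) : ℕ → Polynomial F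
  | 0 => 1
  | 1 => 0
  | n + 2 => (Polynomial.X + Polynomial.C (α (n + 1))) * cfPab α β (n + 1) +
      Polynomial.C (β (n + 1)) * cfPab α β n

/-- Denominators of the modified continued fraction, shifted: `cfQab α β (n+1) = q_n`. -/
def cfQab (α β : ℕ → F) : ℕ → Polynomial F
  | 0 => 0
  | 1 => 1
  | n + 2 => (Polynomial.X + Polynomial.C (α (n + 1))) * cfQab α β (n + 1) +
      Polynomial.C (β (n + 1)) * cfQab α β n

section Polynomials

variable {K : Type*} [Field K]

theorem cfQab_monic_natDegree (α β : ℕ → K) (n : ℕ) :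
    (cfQab α β (n + 1)).Monic ∧ (cfQab α β (n + 1)).natDegree = n := by
  induction n using Nat.twoStepInduction with
  | zero => simp [cfQab]
  | one => simp [cfQab, monic_X_add_C]
  | more n ih0 ih1 =>
    have hm : ((X + C (α (n + 2))) * cfQab α β (n + 2)).Monic :=
      (monic_X_add_C _).mul ih1.1
    have hd : ((X + C (α (n + 2))) * cfQab α β (n + 2)).natDegree = n + 2 := by
      rw [(monic_X_add_C _).natDegree_mul ih1.1, natDegree_X_add_C, ih1.2]
      omega
    have hlt : (C (β (n + 2)) * cfQab α β (n + 1)).natDegree <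
        ((X + C (α (n + 2))) * cfQab α β (n + 2)).natDegree := by
      refine lt_of_le_of_lt (natDegree_C_mul_le _ _) ?_
      rw [hd, ih0.2]
      omega
    rw [show cfQab α β (n + 2 + 1) = (X + C (α (n + 2))) * cfQab α β (n + 2) +
      C (β (n + 2)) * cfQab α β (n + 1) from rfl]
    exact ⟨hm.add_of_left (degree_lt_degree hlt),
      (natDegree_add_eq_left_of_natDegree_lt hlt).trans hd⟩

/-- The even and odd parts of a polynomial are determined by the polynomial. -/
theorem expand_two_add_X_mul_expand_two_inj {A B A' B' : Polynomial K}
    (h : expand K 2 A + X * expand K 2 B = expand K 2 A' + X * expand K 2 B') :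
    A = A' ∧ B = B' := by
  have key (P Q : Polynomial K) (n : ℕ) :
      (expand K 2 P + X * expand K 2 Q).coeff (2 * n) = P.coeff n ∧
      (expand K 2 P + X * expand K 2 Q).coeff (2 * n + 1) = Q.coeff n := by
    refine ⟨?_, ?_⟩
    · rcases n with _ | n
      · simp [coeff_expand]
      · rw [coeff_add, coeff_expand_mul' two_pos, show 2 * (n + 1) = 2 * n + 1 + 1 by ring,
          coeff_X_mul, coeff_expand two_pos, if_neg (by omega), add_zero]
    · rw [coeff_add, coeff_X_mul, coeff_expand_mul' two_pos, coeff_expand two_pos,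
        if_neg (by omega), zero_add]
  constructor <;> ext n
  · rw [← (key A B n).1, h, (key A' B' n).1]
  · rw [← (key A B n).2, h, (key A' B' n).2]

theorem linearMap_mul_eq_sum (L : Polynomial K →ₗ[K] K) (p q : Polynomial K) :
    L (p * q) = ∑ i ∈ Finset.range (p.natDegree + 1), p.coeff i * L (X ^ i * q) := by
  conv_lhs => rw [p.as_sum_range_C_mul_X_pow, Finset.sum_mul, map_sum]
  refine Finset.sum_congr rfl fun i _ => ?_
  rw [mul_assoc, ← smul_eq_C_mul, map_smul, smul_eq_mul]

variable {L : Polynomial K →ₗ[K] K} {u : K} {α β : ℕ → K}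

theorem linearMap_mul_cfQab_eq_zero
    (horth : ∀ n j, j < n → L (X ^ j * cfQab α β (n + 1)) = 0)
    {p : Polynomial K} {n : ℕ} (hp : p.natDegree < n) : L (p * cfQab α β (n + 1)) = 0 := by
  rw [linearMap_mul_eq_sum]
  refine Finset.sum_eq_zero fun i hi => ?_
  rw [horth n i (by have := Finset.mem_range.1 hi; omega), mul_zero]

theorem linearMap_X_pow_mul_cfQab_ne_zero (hβ : ∀ n, 1 ≤ n → β n ≠ 0) (hL : L 1 = 1)
    (horth : ∀ n j, j < n → L (X ^ j * cfQab α β (n + 1)) = 0) (n : ℕ) :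
    L (X ^ n * cfQab α β (n + 1)) ≠ 0 := by
  induction n with
  | zero => simp [cfQab, hL]
  | succ n ih =>
    have h := horth (n + 2) n (by omega)
    rw [show cfQab α β (n + 2 + 1) = (X + C (α (n + 2))) * cfQab α β (n + 2) +
      C (β (n + 2)) * cfQab α β (n + 1) from rfl,
      show X ^ n * ((X + C (α (n + 2))) * cfQab α β (n + 2) +
        C (β (n + 2)) * cfQab α β (n + 1)) = X ^ (n + 1) * cfQab α β (n + 2) +
        C (α (n + 2)) * (X ^ n * cfQab α β (n + 2)) +
        C (β (n + 2)) * (X ^ n * cfQab α β (n + 1)) by ring,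
      map_add, map_add, ← smul_eq_C_mul, ← smul_eq_C_mul, map_smul, map_smul,
      horth (n + 1) n (by omega), smul_zero, add_zero, smul_eq_mul] at h
    intro h'
    rw [h', zero_add] at h
    exact mul_ne_zero (hβ _ (by omega)) ih h

theorem eq_zero_of_linearMap_X_pow_mul_eq_zero (hβ : ∀ n, 1 ≤ n → β n ≠ 0) (hL : L 1 = 1)
    (horth : ∀ n j, j < n → L (X ^ j * cfQab α β (n + 1)) = 0)
    {D : Polynomial K} {n : ℕ} (hD : D.degree < n) (h : ∀ j < n, L (X ^ j * D) = 0) :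
    D = 0 := by
  by_contra hne
  have hlt : D.natDegree < n := (natDegree_lt_iff_degree_lt hne).2 hD
  have h1 : L (D * cfQab α β (D.natDegree + 1)) = 0 := by
    rw [mul_comm, linearMap_mul_eq_sum, (cfQab_monic_natDegree α β _).2]
    refine Finset.sum_eq_zero fun i hi => ?_
    rw [h i (by have := Finset.mem_range.1 hi; omega), mul_zero]
  rw [linearMap_mul_eq_sum, Finset.sum_range_succ, Finset.sum_eq_zero, zero_add] at h1
  · exact mul_ne_zero (leadingCoeff_ne_zero.2 hne)
      (linearMap_X_pow_mul_cfQab_ne_zero hβ hL horth _) h1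
  · intro i hi
    rw [horth _ i (Finset.mem_range.1 hi), mul_zero]

theorem cfQab_two_mul_add_one (hβ : ∀ n, 1 ≤ n → β n ≠ 0) (hL : L 1 = 1)
    (heven : ∀ f, L (expand K 2 f) = L f) (hodd : ∀ f, L (X * expand K 2 f) = u * L f)
    (horth : ∀ n j, j < n → L (X ^ j * cfQab α β (n + 1)) = 0) (n : ℕ) :
    cfQab α β (2 * n + 1) = expand K 2 (cfQab α β (n + 1)) := by
  obtain ⟨hm, hd⟩ := cfQab_monic_natDegree α β n
  obtain ⟨hm2, hd2⟩ := cfQab_monic_natDegree α β (2 * n)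
  have hme : (expand K 2 (cfQab α β (n + 1))).Monic := (monic_expand_iff two_pos).2 hm
  have hde : (expand K 2 (cfQab α β (n + 1))).natDegree = 2 * n := by
    rw [natDegree_expand, hd, mul_comm]
  refine sub_eq_zero.1 (eq_zero_of_linearMap_X_pow_mul_eq_zero hβ hL horth (n := 2 * n) ?_ ?_)
  · have := degree_sub_lt_left (p := cfQab α β (2 * n + 1))
      (by rw [degree_eq_natDegree hm2.ne_zero, degree_eq_natDegree hme.ne_zero, hd2, hde])
      hm2.ne_zero
      (hm2.leadingCoeff.trans hme.leadingCoeff.symm)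
    rwa [degree_eq_natDegree hm2.ne_zero, hd2] at this
  · intro j hj
    rw [mul_sub, map_sub, horth _ j hj, zero_sub, neg_eq_zero]
    obtain ⟨i, rfl | rfl⟩ := Nat.even_or_odd' j
    · rw [show (X : Polynomial K) ^ (2 * i) = expand K 2 (X ^ i) by simp [pow_mul],
        ← map_mul, heven, horth _ i (by omega)]
    · rw [show (X : Polynomial K) ^ (2 * i + 1) = X * expand K 2 (X ^ i) by
        simp [pow_succ', pow_mul], mul_assoc, ← map_mul, hodd, horth _ i (by omega), mul_zero]

theorem alpha_two_mul_add_one (hβ : ∀ n, 1 ≤ n → β n ≠ 0) (hL : L 1 = 1)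
    (heven : ∀ f, L (expand K 2 f) = L f) (hodd : ∀ f, L (X * expand K 2 f) = u * L f)
    (horth : ∀ n j, j < n → L (X ^ j * cfQab α β (n + 1)) = 0) (n : ℕ) :
    α (2 * n + 1) = -u := by
  have hq := cfQab_two_mul_add_one hβ hL heven hodd horth n
  have hd := (cfQab_monic_natDegree α β (2 * n)).2
  have h0 : L (cfQab α β (2 * n + 1) * cfQab α β (2 * n)) = 0 := by
    rcases n with _ | n
    · simp [cfQab]
    · rw [mul_comm]
      refine linearMap_mul_cfQab_eq_zero horth (lt_of_eq_of_lt
        (cfQab_monic_natDegree α β (2 * n + 1)).2 ?_)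
      omega
  have h1 : L (cfQab α β (2 * n + 1) * cfQab α β (2 * n + 2)) = 0 :=
    linearMap_mul_cfQab_eq_zero horth (n := 2 * n + 1) (by omega)
  rw [show cfQab α β (2 * n + 2) = (X + C (α (2 * n + 1))) * cfQab α β (2 * n + 1) +
      C (β (2 * n + 1)) * cfQab α β (2 * n) from rfl,
    show cfQab α β (2 * n + 1) * ((X + C (α (2 * n + 1))) * cfQab α β (2 * n + 1) +
      C (β (2 * n + 1)) * cfQab α β (2 * n)) =
      X * (cfQab α β (2 * n + 1) * cfQab α β (2 * n + 1)) +
      C (α (2 * n + 1)) * (cfQab α β (2 * n + 1) * cfQab α β (2 * n + 1)) +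
      C (β (2 * n + 1)) * (cfQab α β (2 * n + 1) * cfQab α β (2 * n)) by ring,
    map_add, map_add, ← smul_eq_C_mul, ← smul_eq_C_mul, map_smul, map_smul, h0, smul_zero,
    add_zero, hq, ← map_mul, hodd, heven, smul_eq_mul, ← add_mul] at h1
  refine (eq_neg_of_add_eq_zero_right ((mul_eq_zero.1 h1).resolve_right ?_))
  obtain ⟨hm, hd'⟩ := cfQab_monic_natDegree α β n
  rw [linearMap_mul_eq_sum, hd', Finset.sum_range_succ, Finset.sum_eq_zero, zero_add]
  · refine mul_ne_zero ?_ (linearMap_X_pow_mul_cfQab_ne_zero hβ hL horth n)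
    have := hm.coeff_natDegree
    rw [hd'] at this
    simp [this]
  · intro i hi
    rw [horth _ i (Finset.mem_range.1 hi), mul_zero]

/-- The even polynomial `(x + u) q_{2n-1}(x)` and the value `α_{2n+2} = u`, deduced from
`q_{2n}(x) = q_n(x²)` and `α_{2n+1} = -u`. -/
theorem alpha_two_mul_add_two
    (hq : ∀ n, cfQab α β (2 * n + 1) = expand K 2 (cfQab α β (n + 1)))
    (hα : ∀ n, α (2 * n + 1) = -u) (n : ℕ) :
    α (2 * n + 2) = u ∧ (X + C u) * cfQab α β (2 * n + 2) =
      expand K 2 (cfQab α β (n + 2) - C (β (2 * n + 2)) * cfQab α β (n + 1)) := by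
  have step (E : Polynomial K) (n : ℕ) (hE : (X + C u) * cfQab α β (2 * n) = expand K 2 E) :
      α (2 * n + 2) = u ∧ (X + C u) * cfQab α β (2 * n + 2) =
        expand K 2 (cfQab α β (n + 2) - C (β (2 * n + 2)) * cfQab α β (n + 1)) := by
    set E' := (X - C (u ^ 2)) * cfQab α β (n + 1) + C (β (2 * n + 1)) * E with hE'
    have e1 : (X + C u) * cfQab α β (2 * n + 2) = expand K 2 E' := by
      rw [show cfQab α β (2 * n + 2) = (X + C (α (2 * n + 1))) * cfQab α β (2 * n + 1) +
        C (β (2 * n + 1)) * cfQab α β (2 * n) from rfl, hα, hq, hE']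
      simp only [map_add, map_mul, map_sub, expand_X, expand_C, ← hE, map_neg, map_pow]
      ring
    have e2 : expand K 2 (cfQab α β (n + 2)) = (X + C (α (2 * n + 2))) * cfQab α β (2 * n + 2) +
        C (β (2 * n + 2)) * expand K 2 (cfQab α β (n + 1)) := by
      rw [← hq n]
      exact (hq (n + 1)).symm
    have e3 : expand K 2 (C u * cfQab α β (n + 2)) + X * expand K 2 (cfQab α β (n + 2)) =
        expand K 2 (C (α (2 * n + 2)) * E' + C u * (C (β (2 * n + 2)) * cfQab α β (n + 1))) +
        X * expand K 2 (E' + C (β (2 * n + 2)) * cfQab α β (n + 1)) := by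
      simp only [map_add, map_mul, expand_C, ← e1]
      rw [e2]
      ring
    obtain ⟨e4, e5⟩ := expand_two_add_X_mul_expand_two_inj e3
    have hE0 : E' ≠ 0 := by
      intro h
      rw [h, map_zero] at e1
      exact mul_ne_zero (X_add_C_ne_zero u) (cfQab_monic_natDegree α β _).1.ne_zero e1
    have e6 : C (u - α (2 * n + 2)) * E' = 0 := by
      rw [C_sub]
      linear_combination e4 - C u * e5
    refine ⟨?_, by rw [e1, e5, add_sub_cancel_right]⟩
    exact (sub_eq_zero.1 (C_eq_zero.1 ((mul_eq_zero.1 e6).resolve_right hE0))).symm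
  induction n with
  | zero => exact step 0 0 (by simp [cfQab])
  | succ n ih => exact step _ (n + 1) ih.2

theorem cf_relations_of_cfQab_two_mul_add_one
    (hq : ∀ n, cfQab α β (2 * n + 1) = expand K 2 (cfQab α β (n + 1)))
    (hα : ∀ n, α (2 * n + 1) = -u) (k : ℕ) :
    α (2 * k + 2) = u ∧ α (2 * k + 3) = -u ∧
      β (2 * k + 2) * β (2 * k + 3) = -β (k + 2) ∧
      β (2 * k + 3) + β (2 * k + 4) = α (k + 2) + u ^ 2 := by
  obtain ⟨hα2, h1⟩ := alpha_two_mul_add_two hq hα k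
  have h2 := (alpha_two_mul_add_two hq hα (k + 1)).2
  have hα3 : α (2 * k + 3) = -u := hα (k + 1)
  obtain ⟨hm, hd⟩ := cfQab_monic_natDegree α β k
  obtain ⟨hm', hd'⟩ := cfQab_monic_natDegree α β (k + 1)
  have h3 : cfQab α β (k + 3) - C (β (2 * k + 4)) * cfQab α β (k + 2) =
      (X - C (u ^ 2)) * cfQab α β (k + 2) + C (β (2 * k + 3)) *
        (cfQab α β (k + 2) - C (β (2 * k + 2)) * cfQab α β (k + 1)) := by
    refine expand_injective (R := K) two_pos ?_
    rw [map_add, map_mul (expand K 2) (C (β (2 * k + 3))), ← h1]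
    refine h2.symm.trans ?_
    rw [show cfQab α β (2 * (k + 1) + 2) = (X + C (α (2 * k + 3))) * cfQab α β (2 * (k + 1) + 1) +
      C (β (2 * k + 3)) * cfQab α β (2 * k + 2) from rfl, hα3, hq]
    simp only [map_mul, map_sub, expand_X, expand_C, map_neg, map_pow]
    ring
  rw [show cfQab α β (k + 3) = (X + C (α (k + 2))) * cfQab α β (k + 2) +
    C (β (k + 2)) * cfQab α β (k + 1) from rfl] at h3
  have h4 : C (α (k + 2) + u ^ 2 - β (2 * k + 3) - β (2 * k + 4)) * cfQab α β (k + 2) =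
      C (-(β (2 * k + 2) * β (2 * k + 3)) - β (k + 2)) * cfQab α β (k + 1) := by
    simp only [C_add, C_sub, C_neg, C_mul]
    linear_combination h3
  have h5 : α (k + 2) + u ^ 2 - β (2 * k + 3) - β (2 * k + 4) = 0 := by
    have := congrArg (fun p => coeff p (k + 1)) h4
    have hc := hm'.coeff_natDegree
    rw [hd'] at hc
    simpa only [coeff_C_mul, hc, coeff_eq_zero_of_natDegree_lt (hd.trans_lt k.lt_succ_self),
      mul_one, mul_zero] using this
  rw [h5, C_0, zero_mul, eq_comm, mul_eq_zero, C_eq_zero] at h4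
  have h6 := h4.resolve_right hm.ne_zero
  refine ⟨hα2, hα3, ?_, ?_⟩
  · linear_combination -h6
  · linear_combination -h5

end Polynomials

section Series

variable {K : Type*} [Field K]

theorem coeff_prod_one_add_stable (u : K) {n N : ℕ} (h : n + 1 ≤ N) :
    (∏ t ∈ Finset.range N, (1 + C u * X : Polynomial K).comp (X ^ 2 ^ t)).coeff n =
      (∏ t ∈ Finset.range (n + 1), (1 + C u * X : Polynomial K).comp (X ^ 2 ^ t)).coeff n := by
  induction N, h using Nat.le_induction with
  | base => rfl
  | succ N hN ih =>
    have hlt : n < 2 ^ N := lt_trans (by omega) Nat.lt_two_pow_self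
    rw [Finset.prod_range_succ, ← ih]
    simp only [add_comp, one_comp, mul_comp, C_comp, X_comp]
    rw [mul_add, mul_one, coeff_add, ← mul_assoc, coeff_mul_X_pow', if_neg (by omega), add_zero]

theorem prod_one_add_succ (u : K) (N : ℕ) :
    ∏ t ∈ Finset.range (N + 1), (1 + C u * X : Polynomial K).comp (X ^ 2 ^ t) =
      (1 + C u * X) *
        expand K 2 (∏ t ∈ Finset.range N, (1 + C u * X : Polynomial K).comp (X ^ 2 ^ t)) := by
  rw [Finset.prod_range_succ', mul_comm, map_prod]
  simp only [pow_zero, pow_one, comp_X]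
  congr 1
  refine Finset.prod_congr rfl fun t _ => ?_
  simp [pow_succ', pow_mul]

theorem coeff_infProd_even_odd (u : K) (n : ℕ) :
    PowerSeries.coeff (2 * n) (infProd (1 + C u * X) 2) =
        PowerSeries.coeff n (infProd (1 + C u * X) 2) ∧
      PowerSeries.coeff (2 * n + 1) (infProd (1 + C u * X) 2) =
        u * PowerSeries.coeff n (infProd (1 + C u * X) 2) := by
  simp only [infProd, PowerSeries.coeff_mk]
  rw [← coeff_prod_one_add_stable u (N := 2 * n + 1 + 1) (n := 2 * n) (by omega),
    prod_one_add_succ, add_mul, one_mul, mul_assoc, coeff_add, coeff_C_mul, coeff_add,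
    coeff_C_mul, coeff_X_mul, coeff_expand_mul' two_pos, coeff_expand two_pos,
    if_neg (by omega), coeff_prod_one_add_stable u (by omega : n + 1 ≤ 2 * n + 1)]
  refine ⟨?_, by ring⟩
  rcases n with _ | n
  · simp
  · rw [show 2 * (n + 1) = 2 * n + 1 + 1 by ring, coeff_X_mul, coeff_expand two_pos,
      if_neg (by omega), mul_zero, add_zero]

theorem coeff_zero_infProd (u : K) : PowerSeries.coeff 0 (infProd (1 + C u * X) 2) = 1 := by
  simp [infProd]

theorem xx_eq_single : (xx : LaurentSeries K) = HahnSeries.single (-1) 1 := by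
  rw [xx, PowerSeries.coe_X]
  simp [HahnSeries.inv_single]

theorem xx_pow_eq_single (n : ℕ) :
    (xx : LaurentSeries K) ^ n = HahnSeries.single (-(n : ℤ)) 1 := by
  rw [xx_eq_single, HahnSeries.single_pow]
  simp

theorem algebraMap_laurentSeries_eq_single (c : K) :
    algebraMap K (LaurentSeries K) c = HahnSeries.single 0 c := by
  rw [HahnSeries.algebraMap_apply', PowerSeries.algebraMap_apply, Algebra.algebraMap_self_apply,
    HahnSeries.ofPowerSeries_C, HahnSeries.C_apply]

theorem pev_eq_sum (p : Polynomial K) :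
    pev p = ∑ i ∈ Finset.range (p.natDegree + 1), HahnSeries.single (-(i : ℤ)) (p.coeff i) := by
  rw [pev, aeval_def, eval₂_eq_sum_range]
  refine Finset.sum_congr rfl fun i _ => ?_
  rw [algebraMap_laurentSeries_eq_single, xx_pow_eq_single, HahnSeries.single_mul_single,
    zero_add, mul_one]

theorem coeff_pev_eq_zero {p : Polynomial K} {j : ℤ} (hj : 0 < j ∨ j < -(p.natDegree : ℤ)) :
    (pev p).coeff j = 0 := by
  rw [pev_eq_sum, HahnSeries.coeff_sum]
  refine Finset.sum_eq_zero fun i hi => ?_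
  have := Finset.mem_range.1 hi
  exact HahnSeries.coeff_single_of_ne (by omega)

theorem pev_ne_zero {p : Polynomial K} (hp : p.Monic) : pev p ≠ 0 := by
  intro h
  have h1 := congrArg (fun f => HahnSeries.coeff f (-(p.natDegree : ℤ))) h
  simp only [pev_eq_sum, HahnSeries.coeff_sum, HahnSeries.coeff_zero] at h1
  rw [Finset.sum_range_succ, Finset.sum_eq_zero, zero_add, HahnSeries.coeff_single_same,
    hp.coeff_natDegree] at h1
  · exact one_ne_zero h1
  · intro i hi
    have := Finset.mem_range.1 hi
    exact HahnSeries.coeff_single_of_ne (by omega)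

theorem coeff_eq_zero_of_degB_le {f : LaurentSeries K} {m j : ℤ}
    (h : degB f ≤ ((-m : ℤ) : WithBot ℤ)) (hj : j < m) : f.coeff j = 0 := by
  by_cases hf : f = 0
  · simp [hf]
  · rw [degB, if_neg hf, WithBot.coe_le_coe] at h
    exact HahnSeries.coeff_eq_zero_of_lt_order (by omega)

theorem coeff_mul_pev_eq_zero {f : LaurentSeries K} {q : Polynomial K} {m j : ℤ}
    (hf : ∀ i < m, f.coeff i = 0) (hj : j < m - q.natDegree) : (f * pev q).coeff j = 0 := by
  rw [HahnSeries.coeff_mul]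
  refine Finset.sum_eq_zero fun ⟨a, b⟩ hab => ?_
  have hab' := (Finset.mem_antidiagonal.1 hab).2.2
  simp only at hab' ⊢
  by_cases ha : a < m
  · rw [hf a ha, zero_mul]
  · rw [coeff_pev_eq_zero (Or.inr (by omega)), mul_zero]

/-- The moment functional of a Laurent series `g = ∑ μ_n x^{-n-1}`, sending `x^n` to `μ_n`. -/
def moment (g : LaurentSeries K) : Polynomial K →ₗ[K] K where
  toFun q := (g * pev q).coeff 1
  map_add' p q := by simp only [pev, map_add, mul_add, HahnSeries.coeff_add]
  map_smul' c q := by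
    rw [smul_eq_C_mul, pev, map_mul, aeval_C, algebraMap_laurentSeries_eq_single, mul_left_comm,
      HahnSeries.coeff_single_zero_mul, RingHom.id_apply, smul_eq_mul, pev]

theorem moment_X_pow_mul (g : LaurentSeries K) (n : ℕ) (q : Polynomial K) :
    moment g (X ^ n * q) = (g * pev q).coeff (n + 1) := by
  change (g * pev (X ^ n * q)).coeff 1 = _
  rw [show g * pev (X ^ n * q) = HahnSeries.single (-(n : ℤ)) 1 * (g * pev q) by
    rw [← xx_pow_eq_single]
    simp only [pev, map_mul, map_pow, aeval_X]
    ring, HahnSeries.coeff_single_mul, one_mul]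
  congr 1
  ring

theorem moment_gU_X_pow (u : K) (n : ℕ) :
    moment (gU u) (X ^ n) = PowerSeries.coeff n (infProd (1 + C u * X) 2) := by
  rw [← mul_one (X ^ n), moment_X_pow_mul]
  simp only [pev, map_one, mul_one, gU]
  rw [xx, inv_inv, PowerSeries.coe_X, HahnSeries.coeff_single_mul, one_mul, add_sub_cancel_right,
    LaurentSeries.coeff_coe_powerSeries]

theorem moment_gU_one (u : K) : moment (gU u) 1 = 1 := by
  rw [← pow_zero X, moment_gU_X_pow, coeff_zero_infProd]

theorem moment_gU_expand (u : K) (f : Polynomial K) :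
    moment (gU u) (expand K 2 f) = moment (gU u) f := by
  induction f using Polynomial.induction_on' with
  | add p q hp hq => rw [map_add, map_add, map_add, hp, hq]
  | monomial n a =>
    rw [← C_mul_X_pow_eq_monomial, map_mul, expand_C, ← smul_eq_C_mul, ← smul_eq_C_mul,
      map_smul, map_smul, map_pow, expand_X, ← pow_mul, moment_gU_X_pow, moment_gU_X_pow,
      (coeff_infProd_even_odd u n).1]

theorem moment_gU_X_mul_expand (u : K) (f : Polynomial K) :
    moment (gU u) (X * expand K 2 f) = u * moment (gU u) f := by
  induction f using Polynomial.induction_on' with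
  | add p q hp hq => rw [map_add, mul_add, map_add, map_add, hp, hq, mul_add]
  | monomial n a =>
    rw [← C_mul_X_pow_eq_monomial, map_mul (expand K 2), expand_C, mul_left_comm, ← smul_eq_C_mul,
      ← smul_eq_C_mul, map_smul, map_smul, map_pow, expand_X, ← pow_mul, ← pow_succ',
      moment_gU_X_pow, moment_gU_X_pow, (coeff_infProd_even_odd u n).2, smul_eq_mul, smul_eq_mul]
    ring

/-- The approximation property of the convergents makes their denominators orthogonal for the
moment functional. -/
theorem moment_X_pow_mul_eq_zero {g : LaurentSeries K} {p q : Polynomial K} (hq : q.Monic)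
    (h : degB (g - pev p / pev q) ≤ (((-(2 * (q.natDegree : ℤ) + 1)) : ℤ) : WithBot ℤ))
    {j : ℕ} (hj : j < q.natDegree) : moment g (X ^ j * q) = 0 := by
  have hne := pev_ne_zero hq
  have h1 : g * pev q = (g - pev p / pev q) * pev q + pev p := by
    rw [sub_mul, div_mul_cancel₀ _ hne, sub_add_cancel]
  rw [moment_X_pow_mul, h1, HahnSeries.coeff_add, coeff_pev_eq_zero (Or.inl (by omega)), add_zero]
  exact coeff_mul_pev_eq_zero (fun i hi => coeff_eq_zero_of_degB_le h hi) (by omega)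

end Series

/-- Let `u ∉ {0,1}` in a field of characteristic zero, and suppose the
continued fraction of `g_u(x) = x⁻¹∏_{t≥0}(1 + u x^{-2^t})` has all partial quotients
linear, `a_n(x) = x + α_n`, with modified parameters `β_n` (expressed through the
convergent property of `p_n/q_n`).  Then for every `k ≥ 0`:
`α_{2k+2} = u`, `α_{2k+3} = -u`, `β_{2k+2}β_{2k+3} = -β_{k+2}`, and
`β_{2k+3} + β_{2k+4} = α_{k+2} + u²`. -/
theorem gU_cf_relations (u : F) (h0 : u ≠ 0) (h1 : u ≠ 1)
    (α β : ℕ → F) (hβ : ∀ n, 1 ≤ n → β n ≠ 0)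
    (hconv : ∀ n : ℕ,
      degB (gU u - pev (cfPab α β (n + 1)) / pev (cfQab α β (n + 1))) ≤
        (((-(2 * (n : ℤ) + 1)) : ℤ) : WithBot ℤ)) :
    ∀ k : ℕ,
      α (2 * k + 2) = u ∧ α (2 * k + 3) = -u ∧
      β (2 * k + 2) * β (2 * k + 3) = -β (k + 2) ∧
      β (2 * k + 3) + β (2 * k + 4) = α (k + 2) + u ^ 2 := by
  have horth : ∀ n j, j < n → moment (gU u) (X ^ j * cfQab α β (n + 1)) = 0 := by
    intro n j hj
    obtain ⟨hm, hd⟩ := cfQab_monic_natDegree α β n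
    refine moment_X_pow_mul_eq_zero (p := cfPab α β (n + 1)) hm ?_ (hd.symm ▸ hj)
    rw [hd]
    exact hconv n
  exact cf_relations_of_cfQab_two_mul_add_one
    (cfQab_two_mul_add_one hβ (moment_gU_one u) (moment_gU_expand u)
      (moment_gU_X_mul_expand u) horth)
    (alpha_two_mul_add_one hβ (moment_gU_one u) (moment_gU_expand u)
      (moment_gU_X_mul_expand u) horth)

end
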